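/- Let R be an associative ring with unit and let (A, B) be a hereditary complete cotorsion pair in Mod R with kernel ω = A ∩ B. Then: (a) A ∩ ω^∨ = {X ∈ A : id_A(X) < ∞}; (b) pd_B(M) = resdim_ω(M) for every M ∈ ω^∧; (c) pd_ω(M) = resdim_A(M) for every M ∈ A^∧. -/

import Mathlib

noncomputable section

open CategoryTheory CategoryTheory.Limits Opposite DirectSum

universe u

namespace CotorsionDim

variable {R : Type u} [Ring R]

/-- `Ext^n_R(M,N) = 0`. -/
def ExtZero (M N : ModuleCat.{u} R) (n : ℕ) : Prop :=
  IsZero (((Ext ℤ (ModuleCat.{u} R) n).obj (op M)).obj N)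

/-- A pair of composable maps forms a short exact sequence `0 → A → B → C → 0`. -/
def IsSES {A B C : ModuleCat.{u} R} (f : A ⟶ B) (g : B ⟶ C) : Prop :=
  ∃ w : f ≫ g = 0, (CategoryTheory.ShortComplex.mk f g w).ShortExact

/-- relative projective dimension `pd_𝒳(M)` -/
def rpd (𝒳 : Set (ModuleCat.{u} R)) (M : ModuleCat.{u} R) : ℕ∞ :=
  sInf {n : ℕ∞ | ∀ j : ℕ, n < (j : ℕ∞) → ∀ X ∈ 𝒳, ExtZero M X j}

/-- relative injective dimension `id_𝒳(M)` -/
def rid (𝒳 : Set (ModuleCat.{u} R)) (M : ModuleCat.{u} R) : ℕ∞ :=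
  sInf {n : ℕ∞ | ∀ j : ℕ, n < (j : ℕ∞) → ∀ X ∈ 𝒳, ExtZero X M j}

/-- `pd_𝒳(𝒴)` -/
def rpdClass (𝒳 𝒴 : Set (ModuleCat.{u} R)) : ℕ∞ := ⨆ Y : 𝒴, rpd 𝒳 Y

/-- `id_𝒳(𝒴)` -/
def ridClass (𝒳 𝒴 : Set (ModuleCat.{u} R)) : ℕ∞ := ⨆ Y : 𝒴, rid 𝒳 Y

/-- projective dimension -/
def pd (M : ModuleCat.{u} R) : ℕ∞ := rpd Set.univ M

/-- injective dimension -/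
def idim (M : ModuleCat.{u} R) : ℕ∞ := rid Set.univ M

/-- `pd(𝒴)` -/
def pdClass (𝒴 : Set (ModuleCat.{u} R)) : ℕ∞ := ⨆ Y : 𝒴, pd Y.1

/-- `id(𝒴)` -/
def idClass (𝒴 : Set (ModuleCat.{u} R)) : ℕ∞ := ⨆ Y : 𝒴, idim Y.1

/-- `M` has an `𝒳`-resolution `0 → X_n → ⋯ → X_0 → M → 0` of length `n`. -/
def HasResLen (𝒳 : Set (ModuleCat.{u} R)) : ℕ → ModuleCat.{u} R → Prop
  | 0, M => M ∈ 𝒳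
  | n+1, M => ∃ (K X : ModuleCat.{u} R) (f : K ⟶ X) (g : X ⟶ M),
      X ∈ 𝒳 ∧ IsSES f g ∧ HasResLen 𝒳 n K

/-- `M` has an `𝒳`-coresolution `0 → M → X_0 → ⋯ → X_n → 0` of length `n`. -/
def HasCoresLen (𝒳 : Set (ModuleCat.{u} R)) : ℕ → ModuleCat.{u} R → Prop
  | 0, M => M ∈ 𝒳
  | n+1, M => ∃ (X C : ModuleCat.{u} R) (f : M ⟶ X) (g : X ⟶ C),
      X ∈ 𝒳 ∧ IsSES f g ∧ HasCoresLen 𝒳 n C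

/-- `resdim_𝒳(M)` -/
def resdim (𝒳 : Set (ModuleCat.{u} R)) (M : ModuleCat.{u} R) : ℕ∞ :=
  ⨅ n : {n : ℕ // HasResLen 𝒳 n M}, (n : ℕ∞)

/-- `coresdim_𝒳(M)` -/
def coresdim (𝒳 : Set (ModuleCat.{u} R)) (M : ModuleCat.{u} R) : ℕ∞ :=
  ⨅ n : {n : ℕ // HasCoresLen 𝒳 n M}, (n : ℕ∞)

/-- `resdim_𝒳(𝒴)` -/
def resdimClass (𝒳 𝒴 : Set (ModuleCat.{u} R)) : ℕ∞ := ⨆ Y : 𝒴, resdim 𝒳 Y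

/-- `coresdim_𝒳(𝒴)` -/
def coresdimClass (𝒳 𝒴 : Set (ModuleCat.{u} R)) : ℕ∞ := ⨆ Y : 𝒴, coresdim 𝒳 Y

/-- `𝒳^∧`, the class of modules with a finite `𝒳`-resolution. -/
def resClosure (𝒳 : Set (ModuleCat.{u} R)) : Set (ModuleCat.{u} R) :=
  {M | ∃ n, HasResLen 𝒳 n M}

/-- `𝒳^∨`, the class of modules with a finite `𝒳`-coresolution. -/
def coresClosure (𝒳 : Set (ModuleCat.{u} R)) : Set (ModuleCat.{u} R) :=
  {M | ∃ n, HasCoresLen 𝒳 n M}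

/-- `(𝒜, ℬ)` is a cotorsion pair. -/
def IsCotorsionPair (𝒜 ℬ : Set (ModuleCat.{u} R)) : Prop :=
  (∀ M, M ∈ 𝒜 ↔ ∀ B ∈ ℬ, ExtZero M B 1) ∧
  (∀ M, M ∈ ℬ ↔ ∀ A ∈ 𝒜, ExtZero A M 1)

/-- completeness of a cotorsion pair -/
def IsComplete (𝒜 ℬ : Set (ModuleCat.{u} R)) : Prop :=
  ∀ M : ModuleCat.{u} R,
    (∃ (B A : ModuleCat.{u} R) (f : B ⟶ A) (g : A ⟶ M), B ∈ ℬ ∧ A ∈ 𝒜 ∧ IsSES f g) ∧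
    (∃ (B A : ModuleCat.{u} R) (f : M ⟶ B) (g : B ⟶ A), B ∈ ℬ ∧ A ∈ 𝒜 ∧ IsSES f g)

/-- heredity of a cotorsion pair -/
def IsHereditary (𝒜 ℬ : Set (ModuleCat.{u} R)) : Prop :=
  ∀ i : ℕ, 1 ≤ i → ∀ A ∈ 𝒜, ∀ B ∈ ℬ, ExtZero A B i

variable (R)

/-- `𝒫`, the class of modules of finite projective dimension. -/
def P : Set (ModuleCat.{u} R) := {M | pd M < ⊤}

variable {R}

/-- `M` admits a projective resolution consisting of finitely generated projectives,
i.e. `M ∈ mod R`. -/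
def InmodR (M : ModuleCat.{u} R) : Prop :=
  ∃ K : ℕ → ModuleCat.{u} R, K 0 = M ∧ ∀ i : ℕ,
    ∃ (Q : ModuleCat.{u} R) (f : K (i+1) ⟶ Q) (g : Q ⟶ K i),
      Module.Finite R Q ∧ Projective Q ∧ IsSES f g

variable (R)

/-- `𝒫^{<∞} = 𝒫 ∩ mod R`. -/
def Pfin : Set (ModuleCat.{u} R) := {M | pd M < ⊤ ∧ InmodR M}

/-- the big finitistic dimension -/
def bigFindim : ℕ∞ := pdClass (P R)

/-- the little finitistic dimension -/
def littleFindim : ℕ∞ := pdClass (Pfin R)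

variable {R}

/-- `𝒳^{⊥₁}` -/
def rperp1 (𝒳 : Set (ModuleCat.{u} R)) : Set (ModuleCat.{u} R) :=
  {M | ∀ X ∈ 𝒳, ExtZero X M 1}

/-- `^{⊥₁}𝒳` -/
def lperp1 (𝒳 : Set (ModuleCat.{u} R)) : Set (ModuleCat.{u} R) :=
  {M | ∀ X ∈ 𝒳, ExtZero M X 1}

/-- `T^⊥ = {M : Ext^i(T,M) = 0 for all i > 0}` -/
def rperpAll (T : ModuleCat.{u} R) : Set (ModuleCat.{u} R) :=
  {M | ∀ i : ℕ, 0 < i → ExtZero T M i}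

/-- `Add T`: direct summands of arbitrary direct sums of copies of `T`. -/
def AddT (T : ModuleCat.{u} R) : Set (ModuleCat.{u} R) :=
  {M | ∃ (I : Type u) (s : M ⟶ ModuleCat.of R (I →₀ T)) (r : ModuleCat.of R (I →₀ T) ⟶ M),
    s ≫ r = 𝟙 M}

/-- `T` is a tilting module. -/
def IsTilting (T : ModuleCat.{u} R) : Prop :=
  pd T < ⊤ ∧
  (∀ i : ℕ, 0 < i → ∀ I : Type u, ExtZero T (ModuleCat.of R (I →₀ T)) i) ∧
  ∃ n, HasCoresLen (AddT T) n (ModuleCat.of R R)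


/-- `𝒳` is closed under arbitrary direct sums (coproducts). -/
def ClosedUnderCoproducts (𝒳 : Set (ModuleCat.{u} R)) : Prop :=
  ∀ (I : Type u) (f : I → ModuleCat.{u} R), (∀ i, f i ∈ 𝒳) →
    ModuleCat.of R (⨁ i, (f i : Type u)) ∈ 𝒳

/-- `𝒳` is closed under direct summands. -/
def ClosedUnderSummands (𝒳 : Set (ModuleCat.{u} R)) : Prop :=
  ∀ (M N : ModuleCat.{u} R) (s : M ⟶ N) (r : N ⟶ M), s ≫ r = 𝟙 M → N ∈ 𝒳 → M ∈ 𝒳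

lemma extZero_succ_iff {M N : ModuleCat.{u} R} {n : ℕ} :
    ExtZero M N (n + 1) ↔ Subsingleton (Abelian.Ext.{u} M N (n + 1)) := by
  let P := projectiveResolution M
  have hP : ExtZero M N (n + 1) ↔ ∀ f : P.complex.X (n + 1) ⟶ N,
      P.complex.d (n + 2) (n + 1) ≫ f = 0 →
        ∃ g : P.complex.X n ⟶ N, P.complex.d (n + 1) n ≫ g = f := by
    rw [ExtZero, (P.isoExt (n + 1) N).isZero_iff,
      ← HomologicalComplex.exactAt_iff_isZero_homology,
      HomologicalComplex.exactAt_iff' _ n (n + 1) (n + 2) (by simp) (by simp),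
      ShortComplex.moduleCat_exact_iff]
    rfl
  rw [hP]
  refine ⟨fun h ↦ subsingleton_of_forall_eq 0 fun x ↦ ?_, fun h f hf ↦ ?_⟩
  · obtain ⟨f, hf, rfl⟩ := P.extMk_surjective x (n + 2) rfl
    exact (P.extMk_eq_zero_iff f _ rfl hf n rfl).2 (h f hf)
  · exact (P.extMk_eq_zero_iff f (n + 2) rfl hf n rfl).1 (Subsingleton.elim _ _)

section ShortExact

variable {X₁ X₂ X₃ : ModuleCat.{u} R} {f : X₁ ⟶ X₂} {g : X₂ ⟶ X₃} {n : ℕ}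

lemma IsSES.extZero_middle_right (h : IsSES f g) {M : ModuleCat.{u} R}
    (h₁ : ExtZero M X₁ (n + 1)) (h₃ : ExtZero M X₃ (n + 1)) : ExtZero M X₂ (n + 1) := by
  obtain ⟨w, hS⟩ := h
  rw [extZero_succ_iff] at *
  refine subsingleton_of_forall_eq 0 fun x ↦ ?_
  obtain ⟨y, rfl⟩ := Abelian.Ext.covariant_sequence_exact₂ M hS x (h₃.elim _ _)
  rw [h₁.elim y 0, Abelian.Ext.zero_comp]

lemma IsSES.extZero_left_right (h : IsSES f g) {M : ModuleCat.{u} R}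
    (h₃ : ExtZero M X₃ (n + 1)) (h₂ : ExtZero M X₂ (n + 2)) : ExtZero M X₁ (n + 2) := by
  obtain ⟨w, hS⟩ := h
  rw [extZero_succ_iff] at *
  refine subsingleton_of_forall_eq 0 fun x ↦ ?_
  obtain ⟨y, rfl⟩ := Abelian.Ext.covariant_sequence_exact₁ M hS x (h₂.elim _ _) rfl
  rw [h₃.elim y 0, Abelian.Ext.zero_comp]

lemma IsSES.extZero_right_right (h : IsSES f g) {M : ModuleCat.{u} R}
    (h₂ : ExtZero M X₂ (n + 1)) (h₁ : ExtZero M X₁ (n + 2)) : ExtZero M X₃ (n + 1) := by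
  obtain ⟨w, hS⟩ := h
  rw [extZero_succ_iff] at *
  refine subsingleton_of_forall_eq 0 fun x ↦ ?_
  obtain ⟨y, rfl⟩ := Abelian.Ext.covariant_sequence_exact₃ M hS x rfl (h₁.elim _ _)
  rw [h₂.elim y 0, Abelian.Ext.zero_comp]

lemma IsSES.extZero_middle_left (h : IsSES f g) {N : ModuleCat.{u} R}
    (h₁ : ExtZero X₁ N (n + 1)) (h₃ : ExtZero X₃ N (n + 1)) : ExtZero X₂ N (n + 1) := by
  obtain ⟨w, hS⟩ := h
  rw [extZero_succ_iff] at *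
  refine subsingleton_of_forall_eq 0 fun x ↦ ?_
  obtain ⟨y, rfl⟩ := Abelian.Ext.contravariant_sequence_exact₂ hS N x (h₁.elim _ _)
  rw [h₃.elim y 0, Abelian.Ext.comp_zero]

lemma IsSES.extZero_left_left (h : IsSES f g) {N : ModuleCat.{u} R}
    (h₂ : ExtZero X₂ N (n + 1)) (h₃ : ExtZero X₃ N (n + 2)) : ExtZero X₁ N (n + 1) := by
  obtain ⟨w, hS⟩ := h
  rw [extZero_succ_iff] at *
  refine subsingleton_of_forall_eq 0 fun x ↦ ?_
  obtain ⟨y, rfl⟩ := Abelian.Ext.contravariant_sequence_exact₁ hS N x (add_comm _ _)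
    (h₃.elim _ _)
  rw [h₂.elim y 0, Abelian.Ext.comp_zero]

lemma IsSES.extZero_right_left (h : IsSES f g) {N : ModuleCat.{u} R}
    (h₁ : ExtZero X₁ N (n + 1)) (h₂ : ExtZero X₂ N (n + 2)) : ExtZero X₃ N (n + 2) := by
  obtain ⟨w, hS⟩ := h
  rw [extZero_succ_iff] at *
  refine subsingleton_of_forall_eq 0 fun x ↦ ?_
  obtain ⟨y, rfl⟩ := Abelian.Ext.contravariant_sequence_exact₃ hS N x (h₂.elim _ _)
    (add_comm 1 (n + 1))
  rw [h₁.elim y 0, Abelian.Ext.comp_zero]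

lemma IsSES.exists_section (h : IsSES f g) (h₁ : ExtZero X₃ X₁ 1) :
    ∃ s : X₃ ⟶ X₂, s ≫ g = 𝟙 X₃ := by
  obtain ⟨w, hS⟩ := h
  rw [extZero_succ_iff] at h₁
  obtain ⟨y, hy⟩ := Abelian.Ext.covariant_sequence_exact₃ X₃ hS (Abelian.Ext.mk₀ (𝟙 X₃)) rfl
    (h₁.elim _ _)
  obtain ⟨s, rfl⟩ := (Abelian.Ext.mk₀_bijective X₃ X₂).surjective y
  rw [Abelian.Ext.mk₀_comp_mk₀] at hy
  exact ⟨s, (Abelian.Ext.mk₀_bijective X₃ X₃).injective hy⟩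

end ShortExact

lemma ExtZero.of_retract {M M' N : ModuleCat.{u} R} {n : ℕ} (s : M ⟶ M') (r : M' ⟶ M)
    (hsr : s ≫ r = 𝟙 M) (h : ExtZero M' N (n + 1)) : ExtZero M N (n + 1) := by
  rw [extZero_succ_iff] at *
  refine subsingleton_of_forall_eq 0 fun x ↦ ?_
  rw [← Abelian.Ext.mk₀_id_comp x, ← hsr, ← Abelian.Ext.mk₀_comp_mk₀_assoc,
    h.elim ((Abelian.Ext.mk₀ r).comp x (zero_add _)) 0, Abelian.Ext.comp_zero]

section Dimension

variable {𝒳 𝒴 : Set (ModuleCat.{u} R)} {M : ModuleCat.{u} R}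

/-- `Ext^j_R(M, X) = 0` for all `j > n` and all `X ∈ 𝒳`. -/
def ExtLeftBounded (𝒳 : Set (ModuleCat.{u} R)) (n : ℕ) (M : ModuleCat.{u} R) : Prop :=
  ∀ j, n ≤ j → ∀ X ∈ 𝒳, ExtZero M X (j + 1)

/-- `Ext^j_R(X, M) = 0` for all `j > n` and all `X ∈ 𝒳`. -/
def ExtRightBounded (𝒳 : Set (ModuleCat.{u} R)) (n : ℕ) (M : ModuleCat.{u} R) : Prop :=
  ∀ j, n ≤ j → ∀ X ∈ 𝒳, ExtZero X M (j + 1)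

lemma rpd_le_iff {n : ℕ} : rpd 𝒳 M ≤ n ↔ ExtLeftBounded 𝒳 n M := by
  refine ⟨fun h j hj X hX ↦ ?_, fun h ↦ sInf_le fun j hj X hX ↦ ?_⟩
  · obtain ⟨m, hm, hmj⟩ := sInf_lt_iff.1 (lt_of_le_of_lt h
      (show (n : ℕ∞) < ((j + 1 : ℕ) : ℕ∞) by exact_mod_cast Nat.lt_succ_of_le hj))
    exact hm _ hmj X hX
  · have hj : n < j := by exact_mod_cast hj
    obtain ⟨k, rfl⟩ := Nat.exists_eq_succ_of_ne_zero (Nat.ne_zero_of_lt hj)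
    exact h k (by lia) X hX

lemma rid_le_iff {n : ℕ} : rid 𝒳 M ≤ n ↔ ExtRightBounded 𝒳 n M := by
  refine ⟨fun h j hj X hX ↦ ?_, fun h ↦ sInf_le fun j hj X hX ↦ ?_⟩
  · obtain ⟨m, hm, hmj⟩ := sInf_lt_iff.1 (lt_of_le_of_lt h
      (show (n : ℕ∞) < ((j + 1 : ℕ) : ℕ∞) by exact_mod_cast Nat.lt_succ_of_le hj))
    exact hm _ hmj X hX
  · have hj : n < j := by exact_mod_cast hj
    obtain ⟨k, rfl⟩ := Nat.exists_eq_succ_of_ne_zero (Nat.ne_zero_of_lt hj)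
    exact h k (by lia) X hX

lemma rid_lt_top_iff : rid 𝒳 M < ⊤ ↔ ∃ n, ExtRightBounded 𝒳 n M := by
  simp only [← rid_le_iff]
  refine ⟨fun h ↦ ?_, fun ⟨n, hn⟩ ↦ hn.trans_lt (ENat.natCast_lt_top n)⟩
  obtain ⟨n, hn⟩ := ENat.ne_top_iff_exists.1 h.ne
  exact ⟨n, hn.ge⟩

lemma rpd_eq_resdim (h : ∀ n, ExtLeftBounded 𝒳 n M ↔ HasResLen 𝒴 n M) :
    rpd 𝒳 M = resdim 𝒴 M := by
  refine le_antisymm (le_iInf fun n ↦ rpd_le_iff.2 ((h n).2 n.2)) ?_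
  induction hn : rpd 𝒳 M using ENat.recTopCoe with
  | top => exact le_top
  | coe n =>
    exact iInf_le (fun n : {n // HasResLen 𝒴 n M} ↦ (n : ℕ∞))
      ⟨n, (h n).1 (rpd_le_iff.1 hn.le)⟩

lemma HasResLen.extLeftBounded (hXY : ∀ X ∈ 𝒳, ExtLeftBounded 𝒴 0 X) {n : ℕ}
    (h : HasResLen 𝒳 n M) : ExtLeftBounded 𝒴 n M := by
  induction n generalizing M with
  | zero => exact hXY M h
  | succ n ih =>
    obtain ⟨K, X, f, g, hX, hS, hK⟩ := h
    rintro (_ | j) hj Y hY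
    · lia
    · exact hS.extZero_right_left (ih hK j (by lia) Y hY) (hXY X hX _ (Nat.zero_le _) Y hY)

lemma HasCoresLen.extRightBounded (hXY : ∀ X ∈ 𝒳, ExtRightBounded 𝒴 0 X) {n : ℕ}
    (h : HasCoresLen 𝒳 n M) : ExtRightBounded 𝒴 n M := by
  induction n generalizing M with
  | zero => exact hXY M h
  | succ n ih =>
    obtain ⟨X, C, f, g, hX, hS, hC⟩ := h
    rintro (_ | j) hj Y hY
    · lia
    · exact hS.extZero_left_right (ih hC j (by lia) Y hY) (hXY X hX _ (Nat.zero_le _) Y hY)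

/-- If all higher `Ext^j(Y, X)` with `X ∈ 𝒳` vanish, so do those with `X ∈ 𝒳^∧`. -/
lemma HasResLen.extRightBounded_zero (hXY : ∀ X ∈ 𝒳, ExtRightBounded 𝒴 0 X) {n : ℕ}
    (h : HasResLen 𝒳 n M) : ExtRightBounded 𝒴 0 M := by
  induction n generalizing M with
  | zero => exact hXY M h
  | succ n ih =>
    obtain ⟨K, X, f, g, hX, hS, hK⟩ := h
    exact fun j hj Y hY ↦ hS.extZero_right_right (hXY X hX j hj Y hY)
      (ih hK (j + 1) (Nat.zero_le _) Y hY)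

end Dimension

section CotorsionPair

variable {𝒜 ℬ : Set (ModuleCat.{u} R)} {M : ModuleCat.{u} R} {n : ℕ}

lemma IsCotorsionPair.mem_left_of_isSES (hcp : IsCotorsionPair 𝒜 ℬ) {X₁ X₂ X₃ : ModuleCat.{u} R}
    {f : X₁ ⟶ X₂} {g : X₂ ⟶ X₃} (h : IsSES f g) (h₁ : X₁ ∈ 𝒜) (h₃ : X₃ ∈ 𝒜) : X₂ ∈ 𝒜 :=
  (hcp.1 _).2 fun B hB ↦ h.extZero_middle_left ((hcp.1 _).1 h₁ B hB) ((hcp.1 _).1 h₃ B hB)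

lemma IsCotorsionPair.mem_right_of_isSES (hcp : IsCotorsionPair 𝒜 ℬ) {X₁ X₂ X₃ : ModuleCat.{u} R}
    {f : X₁ ⟶ X₂} {g : X₂ ⟶ X₃} (h : IsSES f g) (h₁ : X₁ ∈ ℬ) (h₃ : X₃ ∈ ℬ) : X₂ ∈ ℬ :=
  (hcp.2 _).2 fun A hA ↦ h.extZero_middle_right ((hcp.2 _).1 h₁ A hA) ((hcp.2 _).1 h₃ A hA)

lemma IsHereditary.extLeftBounded (hher : IsHereditary 𝒜 ℬ) {A : ModuleCat.{u} R} (hA : A ∈ 𝒜) :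
    ExtLeftBounded ℬ 0 A :=
  fun j _ B hB ↦ hher (j + 1) (by lia) A hA B hB

lemma IsHereditary.extRightBounded (hher : IsHereditary 𝒜 ℬ) {B : ModuleCat.{u} R} (hB : B ∈ ℬ) :
    ExtRightBounded 𝒜 0 B :=
  fun j _ A hA ↦ hher (j + 1) (by lia) A hA B hB

lemma hasCoresLen_kernel (hcp : IsCotorsionPair 𝒜 ℬ) (hcomp : IsComplete 𝒜 ℬ)
    (hher : IsHereditary 𝒜 ℬ) (hM : M ∈ 𝒜) (h : ExtRightBounded 𝒜 n M) :
    HasCoresLen (𝒜 ∩ ℬ) n M := by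
  induction n generalizing M with
  | zero => exact ⟨hM, (hcp.2 M).2 (h 0 le_rfl)⟩
  | succ n ih =>
    obtain ⟨B, A, f, g, hB, hA, hS⟩ := (hcomp M).2
    refine ⟨B, A, f, g, ⟨hcp.mem_left_of_isSES hS hM hA, hB⟩, hS, ih hA fun j hj X hX ↦ ?_⟩
    exact hS.extZero_right_right (hher _ (by lia) X hX B hB) (h (j + 1) (by lia) X hX)

lemma hasResLen_kernel (hcp : IsCotorsionPair 𝒜 ℬ) (hcomp : IsComplete 𝒜 ℬ)
    (hher : IsHereditary 𝒜 ℬ) (hM : M ∈ ℬ) (h : ExtLeftBounded ℬ n M) :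
    HasResLen (𝒜 ∩ ℬ) n M := by
  induction n generalizing M with
  | zero => exact ⟨(hcp.1 M).2 (h 0 le_rfl), hM⟩
  | succ n ih =>
    obtain ⟨B, A, f, g, hB, hA, hS⟩ := (hcomp M).1
    refine ⟨B, A, f, g, ⟨hA, hcp.mem_right_of_isSES hS hB hM⟩, hS, ih hB fun j hj X hX ↦ ?_⟩
    exact hS.extZero_left_left (hher _ (by lia) A hA X hX) (h (j + 1) (by lia) X hX)

lemma hasResLen_left (hcp : IsCotorsionPair 𝒜 ℬ) (hcomp : IsComplete 𝒜 ℬ)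
    (hher : IsHereditary 𝒜 ℬ) {m : ℕ} (hM : ExtLeftBounded ℬ m M)
    (h : ExtLeftBounded (𝒜 ∩ ℬ) n M) : HasResLen 𝒜 n M := by
  induction n generalizing M with
  | zero =>
    obtain ⟨B, A, f, g, hB, hA, hS⟩ := (hcomp M).1
    have hBm : ExtLeftBounded ℬ m B := fun j hj X hX ↦
      hS.extZero_left_left (hher _ (by lia) A hA X hX) (hM (j + 1) (by lia) X hX)
    have hMB : ExtRightBounded {M} 0 B :=
      (hasResLen_kernel hcp hcomp hher hB hBm).extRightBounded_zero fun W hW j hj Y hY ↦ by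
        obtain rfl := hY
        exact h j hj W hW
    obtain ⟨s, hs⟩ := hS.exists_section (hMB 0 le_rfl M rfl)
    exact (hcp.1 M).2 fun B hB ↦ ((hcp.1 A).1 hA B hB).of_retract s g hs
  | succ n ih =>
    obtain ⟨B, A, f, g, hB, hA, hS⟩ := (hcomp M).1
    refine ⟨B, A, f, g, hA, hS, ih (fun j hj X hX ↦ ?_) fun j hj X hX ↦ ?_⟩
    · exact hS.extZero_left_left (hher _ (by lia) A hA X hX) (hM (j + 1) (by lia) X hX)
    · exact hS.extZero_left_left (hher _ (by lia) A hA X hX.2) (h (j + 1) (by lia) X hX)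

end CotorsionPair

/-- Lemma 2.4: properties of the kernel `ω` of a hereditary complete cotorsion pair. -/
theorem stmt18 {R : Type u} [Ring R] (𝒜 ℬ ω : Set (ModuleCat.{u} R))
    (hcp : IsCotorsionPair 𝒜 ℬ) (hcomp : IsComplete 𝒜 ℬ) (hher : IsHereditary 𝒜 ℬ)
    (hω : ω = 𝒜 ∩ ℬ) :
    (𝒜 ∩ coresClosure ω = {X | X ∈ 𝒜 ∧ rid 𝒜 X < ⊤}) ∧
    (∀ M ∈ resClosure ω, rpd ℬ M = resdim ω M) ∧
    (∀ M ∈ resClosure 𝒜, rpd ω M = resdim 𝒜 M) := by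
  subst hω
  refine ⟨Set.ext fun X ↦ and_congr_right fun hX ↦ ?_, fun M ⟨m, hm⟩ ↦ ?_, fun M ⟨m, hm⟩ ↦ ?_⟩
  · rw [rid_lt_top_iff]
    exact ⟨fun ⟨n, hn⟩ ↦ ⟨n, hn.extRightBounded fun W hW ↦ hher.extRightBounded hW.2⟩,
      fun ⟨n, hn⟩ ↦ ⟨n, hasCoresLen_kernel hcp hcomp hher hX hn⟩⟩
  · have hM : M ∈ ℬ := (hcp.2 M).2
      (hm.extRightBounded_zero (fun W hW ↦ hher.extRightBounded hW.2) 0 le_rfl)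
    exact rpd_eq_resdim fun n ↦ ⟨hasResLen_kernel hcp hcomp hher hM,
      fun h ↦ h.extLeftBounded fun W hW ↦ hher.extLeftBounded hW.1⟩
  · have hM := hm.extLeftBounded fun A hA ↦ hher.extLeftBounded hA
    exact rpd_eq_resdim fun n ↦ ⟨hasResLen_left hcp hcomp hher hM,
      fun h ↦ h.extLeftBounded fun A hA j hj X hX ↦ hher.extLeftBounded hA j hj X hX.2⟩

end CotorsionDim
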